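/- Let f be a nonzero real multi-affine polynomial in variables x_1,…,x_n (i.e., f has degree at most 1 in each variable). Then f is stable if and only if for all real points x ∈ ℝ^n and all pairs of distinct indices i ≠ j, (∂f/∂x_i)(x) · (∂f/∂x_j)(x) ≥ f(x) · (∂²f/∂x_i∂x_j)(x). -/

import Mathlib

namespace MvPolynomial

open Function

section Pderiv

variable {σ R : Type*} [CommRing R]

theorem pderiv_pderiv_comm (i j : σ) (f : MvPolynomial σ R) :
    pderiv i (pderiv j f) = pderiv j (pderiv i f) := by
  classical
  rcases eq_or_ne i j with rfl | hij
  · rfl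
  · ext m
    simp only [coeff_pderiv, Finsupp.add_apply, Finsupp.single_apply, hij, hij.symm, if_false,
      add_zero, add_right_comm m]
    ring

theorem notMem_vars_of_pderiv_eq_zero [IsDomain R] [CharZero R] {i : σ} {f : MvPolynomial σ R}
    (h : pderiv i f = 0) : i ∉ f.vars := by
  classical
  rw [mem_vars_iff_mem_support]
  rintro ⟨m, hm, hi⟩
  have hmi : Finsupp.single i 1 ≤ m := by
    rw [Finsupp.single_le_iff]
    exact Nat.one_le_iff_ne_zero.2 (Finsupp.mem_support_iff.1 hi)
  have key := coeff_pderiv (i := i) f (m - Finsupp.single i 1)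
  rw [h, coeff_zero, tsub_add_cancel_of_le hmi] at key
  rcases mul_eq_zero.1 key.symm with h0 | h0
  · exact mem_support_iff.1 hm h0
  · exact Nat.cast_add_one_ne_zero _ h0

theorem pderiv_pderiv_eq_zero_of_degreeOf_le_one {i : σ} {f : MvPolynomial σ R}
    (h : f.degreeOf i ≤ 1) : pderiv i (pderiv i f) = 0 := by
  ext m
  rw [coeff_pderiv, coeff_pderiv, coeff_zero, notMem_support_iff.1, zero_mul, zero_mul]
  intro hm
  have := (degreeOf_le_iff.1 h) _ hm
  simp at this

variable {A : Type*} [CommRing A] [Algebra R A]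

theorem aeval_update_of_pderiv_eq_zero [DecidableEq σ] [IsDomain R] [CharZero R] {i : σ} {f : MvPolynomial σ R}
    (h : pderiv i f = 0) (z : σ → A) (w : A) : aeval (update z i w) f = aeval z f := by
  simp only [aeval_eq_eval₂Hom]
  refine eval₂Hom_congr' rfl (fun j hj _ => ?_) rfl
  have : j ≠ i := fun e => notMem_vars_of_pderiv_eq_zero h (e ▸ hj)
  simp [this]

theorem aeval_update_of_pderiv_pderiv_eq_zero [DecidableEq σ] [IsDomain R] [CharZero R] {i : σ}
    {f : MvPolynomial σ R} (h : pderiv i (pderiv i f) = 0) (z : σ → A) (w : A) :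
    aeval (update z i w) f = aeval z f + (w - z i) * aeval z (pderiv i f) := by
  have h₁ := aeval_update_of_pderiv_eq_zero h z w
  have h₂ : pderiv i (f - X i * pderiv i f) = 0 := by simp [h]
  have h₃ := aeval_update_of_pderiv_eq_zero h₂ z w
  simp only [map_sub, map_mul, aeval_X, update_self, h₁] at h₃
  linear_combination h₃

end Pderiv

theorem aeval_ofReal {σ : Type*} (x : σ → ℝ) (f : MvPolynomial σ ℝ) :
    aeval (fun i => (x i : ℂ)) f = (eval x f : ℂ) := by
  rw [← coe_aeval_eq_eval]
  exact aeval_algebraMap_apply ℂ x f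

theorem continuous_aeval_complex {σ : Type*} (f : MvPolynomial σ ℝ) :
    Continuous fun z : σ → ℂ => aeval z f := by
  have : (fun z : σ → ℂ => aeval z f) = fun z => eval z (map (algebraMap ℝ ℂ) f) := by
    ext z; rw [eval_map, aeval_def]
  rw [this]
  exact continuous_eval _

/-- Every second pure partial derivative vanishes; in characteristic zero this says that
every variable occurs with degree at most one. -/
def IsMultiAffine {σ : Type*} (f : MvPolynomial σ ℝ) : Prop :=
  ∀ i, pderiv i (pderiv i f) = 0

/-- A real polynomial without zeros in the product of open upper half-planes. -/
def IsStable {σ : Type*} (f : MvPolynomial σ ℝ) : Prop :=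
  ∀ z : σ → ℂ, (∀ j, 0 < (z j).im) → aeval z f ≠ 0

/-- The Rayleigh inequalities on real points. -/
def IsRayleigh {σ : Type*} (f : MvPolynomial σ ℝ) : Prop :=
  ∀ (x : σ → ℝ) (i j : σ), i ≠ j →
    eval x f * eval x (pderiv i (pderiv j f)) ≤ eval x (pderiv i f) * eval x (pderiv j f)

variable {σ : Type*} {f g h : MvPolynomial σ ℝ}

theorem IsMultiAffine.pderiv (hf : IsMultiAffine f) (j : σ) :
    IsMultiAffine (MvPolynomial.pderiv j f) := fun i => by
  rw [pderiv_pderiv_comm i j, pderiv_pderiv_comm i j, hf i, map_zero]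

/-- The approach to a real point along the diagonal imaginary direction. -/
theorem tendsto_aeval_add_I (f : MvPolynomial σ ℝ) (x : σ → ℝ) :
    Filter.Tendsto (fun ε : ℝ => aeval (fun k => (x k : ℂ) + ε * Complex.I) f)
      (nhdsWithin 0 (Set.Ioi 0)) (nhds (eval x f : ℂ)) := by
  have hc : Continuous fun ε : ℝ => aeval (fun k => (x k : ℂ) + ε * Complex.I) f :=
    (continuous_aeval_complex f).comp (by fun_prop)
  have := (hc.tendsto 0).mono_left (nhdsWithin_le_nhds (s := Set.Ioi 0))
  simpa [aeval_ofReal] using this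

variable [DecidableEq σ]

theorem IsMultiAffine.aeval_update (hf : IsMultiAffine f) (z : σ → ℂ) (i : σ) (w : ℂ) :
    aeval (update z i w) f = aeval z f + (w - z i) * aeval z (MvPolynomial.pderiv i f) :=
  aeval_update_of_pderiv_pderiv_eq_zero (hf i) z w

theorem IsMultiAffine.eval_update (hf : IsMultiAffine f) (x : σ → ℝ) (i : σ) (t : ℝ) :
    eval (update x i t) f = eval x f + (t - x i) * eval x (MvPolynomial.pderiv i f) :=
  aeval_update_of_pderiv_pderiv_eq_zero (A := ℝ) (hf i) x t

theorem IsStable.isRayleigh (hs : IsStable f) (hf : IsMultiAffine f) : IsRayleigh f := by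
  intro x i j hij
  by_contra! hlt
  let y : ℝ → σ → ℂ := fun ε k => (x k : ℂ) + ε * Complex.I
  let a : ℝ → ℂ := fun ε => aeval (y ε) f
  let b : ℝ → ℂ := fun ε => aeval (y ε) (MvPolynomial.pderiv i f)
  let c : ℝ → ℂ := fun ε => aeval (y ε) (MvPolynomial.pderiv j f)
  let d : ℝ → ℂ := fun ε => aeval (y ε) (MvPolynomial.pderiv i (MvPolynomial.pderiv j f))
  have hne : (eval x (MvPolynomial.pderiv j f) : ℂ) +
      Complex.I * eval x (MvPolynomial.pderiv i (MvPolynomial.pderiv j f)) ≠ 0 := by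
    intro h0
    have h₁ := congrArg Complex.re h0
    have h₂ := congrArg Complex.im h0
    simp at h₁ h₂
    simp [h₁, h₂] at hlt
  have hlim := ((((tendsto_aeval_add_I f x).add
    ((tendsto_aeval_add_I (MvPolynomial.pderiv i f) x).const_mul Complex.I)).neg).div
    ((tendsto_aeval_add_I (MvPolynomial.pderiv j f) x).add
      ((tendsto_aeval_add_I (MvPolynomial.pderiv i (MvPolynomial.pderiv j f)) x).const_mul
        Complex.I)) hne)
  have hden := ((tendsto_aeval_add_I (MvPolynomial.pderiv j f) x).add
      ((tendsto_aeval_add_I (MvPolynomial.pderiv i (MvPolynomial.pderiv j f)) x).const_mul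
        Complex.I)).eventually_ne hne
  have him := (Complex.continuous_im.tendsto _).comp hlim
  have hpos : 0 < (-((eval x f : ℂ) + Complex.I * eval x (MvPolynomial.pderiv i f)) /
      ((eval x (MvPolynomial.pderiv j f) : ℂ) +
      Complex.I * eval x (MvPolynomial.pderiv i (MvPolynomial.pderiv j f)))).im := by
    have hn : 0 < Complex.normSq ((eval x (MvPolynomial.pderiv j f) : ℂ) +
      Complex.I * eval x (MvPolynomial.pderiv i (MvPolynomial.pderiv j f))) :=
      Complex.normSq_pos.2 hne
    rw [Complex.div_im, ← sub_div]
    apply div_pos _ hn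
    simp
    linarith
  have hev := him.eventually_const_lt hpos
  obtain ⟨ε, ⟨hε, hd⟩, hε0 : 0 < ε⟩ := ((hev.and hden).and self_mem_nhdsWithin).exists
  set t : ℂ := -(a ε + Complex.I * b ε) / (c ε + Complex.I * d ε) with ht
  have ht0 : 0 < t.im := hε
  refine hs (update (update (y ε) i (y ε i + Complex.I)) j (y ε j + t)) (fun k => ?_) ?_
  · have hyk : 0 < (y ε k).im := by simpa [y] using hε0
    rcases eq_or_ne k j with rfl | hkj
    · simpa using add_pos hyk ht0
    · rcases eq_or_ne k i with rfl | hki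
      · simp only [ne_eq, hkj, not_false_eq_true, update_of_ne, update_self, Complex.add_im,
          Complex.I_im]
        linarith
      · simpa [hkj, hki] using hyk
  · rw [hf.aeval_update, hf.aeval_update, (hf.pderiv j).aeval_update, update_of_ne hij.symm]
    change a ε + _ * b ε + _ * (c ε + _ * d ε) = 0
    have : t * (c ε + Complex.I * d ε) = -(a ε + Complex.I * b ε) := div_mul_cancel₀ _ hd
    linear_combination this

theorem _root_.forall_of_forall_update {ι β : Type*} [Fintype ι] [DecidableEq ι] {S : Set β}
    {P : (ι → β) → Prop} {z₀ : ι → β} (h₀ : ∀ i, z₀ i ∈ S) (hP : P z₀)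
    (step : ∀ z i w, (∀ j, z j ∈ S) → w ∈ S → P z → P (update z i w))
    (z : ι → β) (hz : ∀ i, z i ∈ S) : P z := by
  have key : ∀ t : Finset ι, P (t.piecewise z z₀) := by
    intro t
    induction t using Finset.induction_on with
    | empty => simpa using hP
    | insert i t _ ih =>
      rw [Finset.piecewise_insert]
      refine step _ _ _ (fun j => ?_) (hz i) ih
      by_cases hj : j ∈ t <;> simp [hj, hz, h₀]
  simpa using key Finset.univ

/-- The polynomial obtained from a polynomial that is affine in the variable `j` by
substituting the constant `t` for that variable. -/
noncomputable def substVar (j : σ) (t : ℝ) (f : MvPolynomial σ ℝ) : MvPolynomial σ ℝ :=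
  f + (C t - X j) * MvPolynomial.pderiv j f

omit [DecidableEq σ] in
theorem pderiv_substVar_of_ne {i j : σ} (hij : i ≠ j) (t : ℝ) (f : MvPolynomial σ ℝ) :
    MvPolynomial.pderiv i (substVar j t f) = substVar j t (MvPolynomial.pderiv i f) := by
  simp [substVar, pderiv_X_of_ne hij.symm, pderiv_pderiv_comm i j]

theorem IsMultiAffine.pderiv_substVar_self (hf : IsMultiAffine f) (j : σ) (t : ℝ) :
    MvPolynomial.pderiv j (substVar j t f) = 0 := by
  simp [substVar, hf j]

theorem IsMultiAffine.substVar (hf : IsMultiAffine f) (j : σ) (t : ℝ) :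
    IsMultiAffine (substVar j t f) := fun i => by
  rcases eq_or_ne i j with rfl | hij
  · rw [hf.pderiv_substVar_self, map_zero]
  · rw [pderiv_substVar_of_ne hij, pderiv_substVar_of_ne hij, hf i]
    simp [MvPolynomial.substVar]

theorem IsMultiAffine.eval_substVar (hf : IsMultiAffine f) (j : σ) (t : ℝ) (x : σ → ℝ) :
    eval x (MvPolynomial.substVar j t f) = eval (update x j t) f := by
  rw [hf.eval_update]
  simp [MvPolynomial.substVar]

theorem IsRayleigh.substVar (hr : IsRayleigh f) (hf : IsMultiAffine f) (j : σ) (t : ℝ) :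
    IsRayleigh (substVar j t f) := by
  intro x i k hik
  rcases eq_or_ne k j with rfl | hkj
  · simp [hf.pderiv_substVar_self]
  · rcases eq_or_ne i j with rfl | hij
    · simp [pderiv_pderiv_comm i k, hf.pderiv_substVar_self]
    · simpa only [pderiv_substVar_of_ne hkj, pderiv_substVar_of_ne hij, hf.eval_substVar,
        (hf.pderiv k).eval_substVar, (hf.pderiv i).eval_substVar,
        ((hf.pderiv k).pderiv i).eval_substVar] using hr (update x j t) i k hik

theorem _root_.nonneg_of_forall_quadratic_nonneg {a b c : ℝ}
    (H : ∀ t : ℝ, 0 ≤ a + b * t + c * t ^ 2) : 0 ≤ c := by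
  by_contra! hc
  have h₁ := H ((|a| + |b|) / (-c) + 1)
  set t := (|a| + |b|) / (-c) + 1 with ht
  have hq : 0 ≤ (|a| + |b|) / (-c) := by have := neg_pos.2 hc; positivity
  have h₂ : t * (-c) = |a| + |b| - c := by
    rw [ht, add_mul, div_mul_cancel₀ _ (neg_pos.2 hc).ne']; ring
  have ht1 : 1 ≤ t := by linarith
  nlinarith [le_abs_self a, le_abs_self b, abs_nonneg a, abs_nonneg b,
    mul_le_mul_of_nonneg_right (le_abs_self b) (by linarith : 0 ≤ t),
    mul_nonneg (abs_nonneg a) (by linarith : 0 ≤ t - 1)]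

theorem IsRayleigh.pderiv (hr : IsRayleigh f) (hf : IsMultiAffine f) (j : σ) :
    IsRayleigh (MvPolynomial.pderiv j f) := by
  intro x i k hik
  rcases eq_or_ne k j with rfl | hkj
  · simp [hf k]
  · rcases eq_or_ne i j with rfl | hij
    · simp [pderiv_pderiv_comm i k, hf i]
    · have key : ∀ t : ℝ, _ := fun t => sub_nonneg.2 (hr (update x j (x j + t)) i k hik)
      simp only [hf.eval_update, (hf.pderiv k).eval_update, (hf.pderiv i).eval_update,
        ((hf.pderiv k).pderiv i).eval_update, add_sub_cancel_left] at key
      rw [← sub_nonneg, pderiv_pderiv_comm k j, pderiv_pderiv_comm i j, pderiv_pderiv_comm i j]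
      refine nonneg_of_forall_quadratic_nonneg
        (a := eval x (MvPolynomial.pderiv i f) * eval x (MvPolynomial.pderiv k f) -
          eval x f * eval x (MvPolynomial.pderiv i (MvPolynomial.pderiv k f)))
        (b := eval x (MvPolynomial.pderiv i f) *
            eval x (MvPolynomial.pderiv j (MvPolynomial.pderiv k f)) +
          eval x (MvPolynomial.pderiv j (MvPolynomial.pderiv i f)) *
            eval x (MvPolynomial.pderiv k f) -
          eval x f *
            eval x (MvPolynomial.pderiv j (MvPolynomial.pderiv i (MvPolynomial.pderiv k f))) -
          eval x (MvPolynomial.pderiv j f) *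
            eval x (MvPolynomial.pderiv i (MvPolynomial.pderiv k f))) fun t => ?_
      refine (key t).trans_eq ?_
      ring

theorem im_div_eq_zero_of_pderiv_mul_eq [Fintype σ] (hg : IsMultiAffine g) (hh : IsMultiAffine h)
    (hs : IsStable h) (h₀ : h ≠ 0)
    (hd : ∀ i, MvPolynomial.pderiv i g * h = MvPolynomial.pderiv i h * g)
    (z : σ → ℂ) (hz : ∀ j, 0 < (z j).im) : (aeval z g / aeval z h).im = 0 := by
  have hconst : ∀ w : σ → ℂ, (∀ j, 0 < (w j).im) →
      aeval w g = aeval z g / aeval z h * aeval w h := by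
    refine forall_of_forall_update (S := {w : ℂ | 0 < w.im}) hz ?_ ?_
    · rw [div_mul_cancel₀ _ (hs z hz)]
    · intro w i v hw _ hP
      have e := congrArg (aeval w) (hd i)
      rw [map_mul, map_mul] at e
      rw [hg.aeval_update, hh.aeval_update]
      refine mul_right_cancel₀ (hs w hw) ?_
      linear_combination (aeval w h + (v - w i) * aeval w (MvPolynomial.pderiv i h)) * hP +
        (v - w i) * e
  obtain ⟨x, hx⟩ : ∃ x, eval x h ≠ 0 := by
    by_contra! hx
    exact h₀ (funext fun x => by simp [hx x])
  have hlim : (eval x g : ℂ) = aeval z g / aeval z h * eval x h := by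
    refine tendsto_nhds_unique (tendsto_aeval_add_I g x)
      (((tendsto_aeval_add_I h x).const_mul _).congr' ?_)
    filter_upwards [self_mem_nhdsWithin] with ε (hε : 0 < ε)
    exact (hconst _ fun j => by simpa using hε).symm
  have hx' : (eval x h : ℂ) ≠ 0 := by exact_mod_cast hx
  rw [eq_comm, ← eq_div_iff hx', ← Complex.ofReal_div] at hlim
  rw [hlim, Complex.ofReal_im]

omit [DecidableEq σ] in
theorem im_pos_or_im_neg_of_continuousOn {F : (σ → ℂ) → ℂ}
    (hF : ContinuousOn F {z | ∀ j, 0 < (z j).im})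
    (h0 : ∀ z : σ → ℂ, (∀ j, 0 < (z j).im) → (F z).im ≠ 0) :
    (∀ z : σ → ℂ, (∀ j, 0 < (z j).im) → 0 < (F z).im) ∨
      ∀ z : σ → ℂ, (∀ j, 0 < (z j).im) → (F z).im < 0 := by
  by_contra! H
  obtain ⟨⟨z, hz, hz0⟩, w, hw, hw0⟩ := H
  have hconv : Convex ℝ {z : σ → ℂ | ∀ j, 0 < (z j).im} := by
    have := convex_pi (s := Set.univ) (t := fun _ : σ => {w : ℂ | 0 < w.im})
      fun _ _ => convex_halfSpace_im_gt 0
    simpa [Set.pi] using this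
  obtain ⟨v, hv, hv0⟩ := hconv.isPreconnected.intermediate_value hz hw
    (Complex.continuous_im.comp_continuousOn hF) ⟨hz0, hw0⟩
  exact h0 v hv hv0

/-- The inductive step: stability of the leading coefficient and of all nonzero real
specializations in one variable, together with the Rayleigh inequalities, implies stability. -/
theorem IsRayleigh.isStable_of_substVar [Fintype σ] (hr : IsRayleigh f) (hf : IsMultiAffine f)
    (j : σ) (h₀ : MvPolynomial.pderiv j f ≠ 0) (hd : IsStable (MvPolynomial.pderiv j f))
    (hs : ∀ t, MvPolynomial.substVar j t f ≠ 0 → IsStable (MvPolynomial.substVar j t f)) :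
    IsStable f := by
  set h := MvPolynomial.pderiv j f with hh
  set g := MvPolynomial.substVar j 0 f with hg
  have hgz : ∀ z : σ → ℂ, aeval z f = aeval z g + z j * aeval z h := fun z => by
    simp [hg, MvPolynomial.substVar, ← hh]
  have hsz : ∀ (t : ℝ) (z : σ → ℂ),
      aeval z (MvPolynomial.substVar j t f) = aeval z g + t * aeval z h := fun t z => by
    simp only [hg, MvPolynomial.substVar, ← hh, map_add, map_mul, map_sub, aeval_C, aeval_X,
      Complex.coe_algebraMap, Complex.ofReal_zero]
    ring
  by_cases hex : ∃ t, MvPolynomial.substVar j t f = 0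
  · obtain ⟨t, ht⟩ := hex
    intro z hz hz0
    have e := hsz t z
    rw [ht, map_zero] at e
    rw [hgz] at hz0
    have : (z j - t) * aeval z h = 0 := by linear_combination hz0 + e
    rcases mul_eq_zero.1 this with h1 | h1
    · have := congrArg Complex.im h1
      simp at this
      exact (hz j).ne' this
    · exact hd z hz h1
  push Not at hex
  have him : ∀ z : σ → ℂ, (∀ j, 0 < (z j).im) → (aeval z g / aeval z h).im ≠ 0 := by
    intro z hz h0
    refine hs (-(aeval z g / aeval z h).re) (hex _) z hz ?_
    have e : ((aeval z g / aeval z h).re : ℂ) = aeval z g / aeval z h :=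
      Complex.ext (by simp) (by simp [h0])
    rw [hsz, Complex.ofReal_neg, e, neg_mul, div_mul_cancel₀ _ (hd z hz), add_neg_cancel]
  have hcont : ContinuousOn (fun z : σ → ℂ => aeval z g / aeval z h) {z | ∀ j, 0 < (z j).im} :=
    (continuous_aeval_complex g).continuousOn.div (continuous_aeval_complex h).continuousOn hd
  rcases im_pos_or_im_neg_of_continuousOn hcont him with hpos | hneg
  · intro z hz hz0
    have e : aeval z g / aeval z h = -z j := by
      rw [div_eq_iff (hd z hz)]; linear_combination hz0 - hgz z
    have := hpos z hz
    simp only [e, Complex.neg_im] at this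
    linarith [hz j]
  · exfalso
    set r := f - 2 * X j * h with hr'
    have hrs : IsStable r := by
      intro z hz hz0
      have e : aeval z g / aeval z h = z j := by
        rw [div_eq_iff (hd z hz)]
        simp only [hr', map_sub, map_mul, aeval_X, hgz, map_ofNat] at hz0
        linear_combination hz0
      have := hneg z hz
      simp only [e] at this
      linarith [hz j]
    have hrj : MvPolynomial.pderiv j r = -h := by
      have : MvPolynomial.pderiv j (2 : MvPolynomial σ ℝ) = 0 := pderiv_C (a := 2)
      simp only [hr', map_sub, pderiv_mul, this, pderiv_X_self, hh, hf j]
      ring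
    have hri : ∀ (q : MvPolynomial σ ℝ) (i), i ≠ j →
        MvPolynomial.pderiv i (2 * X j * q) = 2 * X j * MvPolynomial.pderiv i q := by
      intro q i hij
      have : MvPolynomial.pderiv i (2 : MvPolynomial σ ℝ) = 0 := pderiv_C (a := 2)
      simp [this, pderiv_X_of_ne hij.symm]
    have hrm : IsMultiAffine r := by
      intro i
      rcases eq_or_ne i j with rfl | hij
      · rw [hrj, map_neg, hh, hf i, neg_zero]
      · rw [hr', map_sub, map_sub, hri _ _ hij, hri _ _ hij, hf i, hf.pderiv j i, mul_zero,
          sub_zero]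
    have hrr := hrs.isRayleigh hrm
    have hz : ∀ j : σ, 0 < ((fun _ : σ => Complex.I) j).im := by simp
    refine him _ hz
      (im_div_eq_zero_of_pderiv_mul_eq (hf.substVar j 0) (hf.pderiv j) hd h₀ ?_ _ hz)
    intro i
    rcases eq_or_ne i j with rfl | hij
    · rw [hf.pderiv_substVar_self, hf i, zero_mul, zero_mul]
    · refine funext fun x => ?_
      have e₁ := hr x i j hij
      have e₂ := hrr x i j hij
      rw [hrj, hr', (MvPolynomial.pderiv i).map_sub, hri _ _ hij] at e₂
      rw [pderiv_substVar_of_ne hij]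
      simp only [MvPolynomial.substVar, ← pderiv_pderiv_comm i j, ← hh, map_add, map_mul, map_sub,
        map_neg, eval_C, eval_X, map_ofNat] at e₁ e₂ ⊢
      linarith

theorem IsRayleigh.isStable [Fintype σ] (hr : IsRayleigh f) (hf : IsMultiAffine f) (h₀ : f ≠ 0) :
    IsStable f := by
  suffices H : ∀ (s : Finset σ) (f : MvPolynomial σ ℝ), IsRayleigh f → IsMultiAffine f → f ≠ 0 →
      (∀ j, j ∉ s → MvPolynomial.pderiv j f = 0) → IsStable f from
    H Finset.univ f hr hf h₀ (by simp)
  intro s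
  induction s using Finset.induction_on with
  | empty =>
    intro f _ hf h₀ hv z _ hz0
    refine h₀ (funext fun x => ?_)
    have := forall_of_forall_update (S := Set.univ) (P := fun w => aeval w f = 0) (by simp) hz0
      (fun w i v _ _ hw => by simp [hf.aeval_update, hw, hv i]) (fun k => (x k : ℂ)) (by simp)
    rw [aeval_ofReal] at this
    simpa using this
  | insert j s _ ih =>
    intro f hr hf h₀ hv
    have hv' : ∀ k, k ∉ s → k ≠ j → MvPolynomial.pderiv k f = 0 := fun k hk hkj =>
      hv k (by simp [hk, hkj])
    by_cases hj : MvPolynomial.pderiv j f = 0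
    · refine ih f hr hf h₀ fun k hk => ?_
      rcases eq_or_ne k j with rfl | hkj
      exacts [hj, hv' k hk hkj]
    · refine hr.isStable_of_substVar hf j hj
        (ih _ (hr.pderiv hf j) (hf.pderiv j) hj fun k hk => ?_)
        fun t ht => ih _ (hr.substVar hf j t) (hf.substVar j t) ht fun k hk => ?_
      · rcases eq_or_ne k j with rfl | hkj
        · exact hf k
        · rw [pderiv_pderiv_comm, hv' k hk hkj, map_zero]
      · rcases eq_or_ne k j with rfl | hkj
        · exact hf.pderiv_substVar_self k t
        · rw [pderiv_substVar_of_ne hkj, hv' k hk hkj]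
          simp [MvPolynomial.substVar]

end MvPolynomial

/-- **Theorem (Brändén: stability of multi-affine real polynomials).**
A nonzero real multi-affine polynomial `f` in `x_1,…,x_n` is stable if and only if for
all real `x` and all pairs of distinct indices `i ≠ j`,
`(∂f/∂x_i)(x) · (∂f/∂x_j)(x) ≥ f(x) · (∂²f/∂x_i∂x_j)(x)`. -/
theorem stmt12 (n : ℕ) (f : MvPolynomial (Fin n) ℝ) (hf : f ≠ 0)
    (hma : ∀ i, f.degreeOf i ≤ 1) :
    (∀ z : Fin n → ℂ, (∀ j, 0 < (z j).im) → MvPolynomial.aeval z f ≠ 0) ↔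
      (∀ (x : Fin n → ℝ) (i j : Fin n), i ≠ j →
        MvPolynomial.eval x f *
            MvPolynomial.eval x (MvPolynomial.pderiv i (MvPolynomial.pderiv j f)) ≤
          MvPolynomial.eval x (MvPolynomial.pderiv i f) *
            MvPolynomial.eval x (MvPolynomial.pderiv j f)) := by
  have hf' : f.IsMultiAffine := fun i =>
    MvPolynomial.pderiv_pderiv_eq_zero_of_degreeOf_le_one (hma i)
  exact ⟨fun hs => MvPolynomial.IsStable.isRayleigh hs hf',
    fun hr => MvPolynomial.IsRayleigh.isStable hr hf' hf⟩
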